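/- Let (A_n)_{n∈ℕ} be a sequence of symmetric matrices with integer entries, A_n of size d_n × d_n, such that all eigenvalues of every A_n are bounded in absolute value by a fixed real R ≥ 1. Let (v_n) be positive reals with d_n ≤ c · v_n for a fixed constant c ≥ 0, and define the finite Borel measure μ_n on ℝ by μ_n = v_n^{-1} Σ_{i=1}^{d_n} δ_{λ_i(A_n)}, where λ_1(A_n), …, λ_{d_n}(A_n) are the eigenvalues of A_n with multiplicity and δ_t is the Dirac measure at t. If μ_n converges weakly to a finite Borel measure μ, then lim_{n→∞} μ_n({0}) = μ({0}). -/

import Mathlib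

open MeasureTheory Filter Topology Polynomial

/-- If an integer polynomial splits over `ℝ`, is monic there, and has roots `lam i`, then the
product of the absolute values of the nonzero roots is at least `1`. -/
theorem one_le_prod_abs_of_map_eq_prod {ι : Type*} [Fintype ι] (p : ℤ[X]) (lam : ι → ℝ)
    (hp : p.map (Int.castRingHom ℝ) = ∏ i, (X - C (lam i))) :
    1 ≤ ∏ i with lam i ≠ 0, |lam i| := by
  classical
  set k := (Finset.univ.filter fun i => ¬ lam i ≠ 0).card with hk
  have hfactor : p.map (Int.castRingHom ℝ)
      = X ^ k * ∏ i with lam i ≠ 0, (X - C (lam i)) := by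
    rw [hp, ← Finset.prod_filter_mul_prod_filter_not Finset.univ (fun i => lam i ≠ 0), mul_comm,
      hk, ← Finset.prod_const]
    congr 1
    refine Finset.prod_congr rfl fun i hi => ?_
    have h0 : lam i = 0 := by simpa using hi
    simp [h0]
  have hcoeff : ((p.coeff k : ℤ) : ℝ) = ∏ i with lam i ≠ 0, (-lam i) := by
    have h := congrArg (fun q => coeff q k) hfactor
    simpa [coeff_X_pow_mul', coeff_zero_eq_eval_zero, eval_prod] using h
  have habs : ((|p.coeff k| : ℤ) : ℝ) = ∏ i with lam i ≠ 0, |lam i| := by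
    rw [Int.cast_abs, hcoeff, Finset.abs_prod]
    simp
  have hpos : 0 < ∏ i with lam i ≠ 0, |lam i| :=
    Finset.prod_pos fun i hi => abs_pos.2 (Finset.mem_filter.1 hi).2
  rw [← habs] at hpos ⊢
  exact_mod_cast hpos

/-- The tent function of height `1` supported on `[-1/k, 1/k]`. -/
noncomputable def tent (k : ℕ) : BoundedContinuousFunction ℝ ℝ :=
  BoundedContinuousFunction.ofNormedAddCommGroup (fun t => max 0 (1 - k * |t|))
    (by fun_prop) 1 fun t => by
      have : 0 ≤ (k : ℝ) * |t| := by positivity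
      rw [Real.norm_eq_abs, abs_of_nonneg (le_max_left _ _)]
      exact max_le zero_le_one (by linarith)

theorem tent_apply (k : ℕ) (t : ℝ) : tent k t = max 0 (1 - k * |t|) := rfl

theorem tent_zero (k : ℕ) : tent k 0 = 1 := by simp [tent_apply]

theorem tent_nonneg (k : ℕ) (t : ℝ) : 0 ≤ tent k t := le_max_left _ _

theorem tent_le_one (k : ℕ) (t : ℝ) : tent k t ≤ 1 := by
  have : 0 ≤ (k : ℝ) * |t| := by positivity
  exact max_le zero_le_one (by linarith)

theorem log_abs_add_tent_mul_log_le {k : ℕ} (hk : 1 ≤ k) {R t : ℝ} (hR : 1 ≤ R) (ht : t ≠ 0)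
    (htR : |t| ≤ R) : Real.log |t| + tent k t * Real.log k ≤ Real.log R := by
  have hk' : (1 : ℝ) ≤ k := by exact_mod_cast hk
  have hlogk : 0 ≤ Real.log k := Real.log_nonneg hk'
  have ht' : 0 < |t| := abs_pos.2 ht
  rcases le_total (k * |t|) 1 with h | h
  · have h1 : Real.log k + Real.log |t| ≤ 0 := by
      rw [← Real.log_mul (by positivity) ht'.ne']
      exact Real.log_nonpos (by positivity) h
    have h2 := mul_le_mul_of_nonneg_right (tent_le_one k t) hlogk
    have h3 := Real.log_nonneg hR
    linarith
  · have h1 : tent k t = 0 := by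
      rw [tent_apply]
      exact max_eq_left (by linarith)
    rw [h1, zero_mul, add_zero]
    exact Real.log_le_log ht' htR

theorem tendsto_integral_tent (μ : Measure ℝ) [IsFiniteMeasure μ] :
    Tendsto (fun k => ∫ t, tent k t ∂μ) atTop (𝓝 (μ.real {0})) := by
  have hind : ∫ t, ({0} : Set ℝ).indicator 1 t ∂μ = μ.real {0} :=
    integral_indicator_one (measurableSet_singleton 0)
  rw [← hind]
  refine tendsto_integral_of_dominated_convergence (fun _ => 1)
    (fun k => (tent k).continuous.aestronglyMeasurable) (integrable_const 1)
    (fun k => ae_of_all _ fun t => ?_) (ae_of_all _ fun t => ?_)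
  · rw [Real.norm_eq_abs, abs_of_nonneg (tent_nonneg k t)]
    exact tent_le_one k t
  · by_cases ht : t = 0
    · simp [ht, tent_zero]
    · have hlim : Tendsto (fun k : ℕ => (k : ℝ) * |t|) atTop atTop :=
        tendsto_natCast_atTop_atTop.atTop_mul_const (abs_pos.2 ht)
      refine tendsto_const_nhds.congr' ?_
      filter_upwards [hlim.eventually_ge_atTop 1] with k hk
      rw [Set.indicator_of_notMem (by simpa using ht), tent_apply, max_eq_left (by linarith)]

/-- Few nonzero roots of a monic integer polynomial with bounded real roots are close to zero. -/
theorem sum_tent_mul_log_le {ι : Type*} [Fintype ι] (p : ℤ[X]) (lam : ι → ℝ)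
    (hp : p.map (Int.castRingHom ℝ) = ∏ i, (X - C (lam i))) {R : ℝ} (hR : 1 ≤ R)
    (hbd : ∀ i, |lam i| ≤ R) {k : ℕ} (hk : 1 ≤ k) :
    (∑ i with lam i ≠ 0, tent k (lam i)) * Real.log k ≤ Fintype.card ι * Real.log R := by
  have hlog : 0 ≤ ∑ i with lam i ≠ 0, Real.log |lam i| := by
    rw [← Real.log_prod fun i hi => (abs_pos.2 (Finset.mem_filter.1 hi).2).ne']
    exact Real.log_nonneg (one_le_prod_abs_of_map_eq_prod p lam hp)
  have hsum : ∑ i with lam i ≠ 0, (Real.log |lam i| + tent k (lam i) * Real.log k)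
      ≤ ∑ i with lam i ≠ 0, Real.log R :=
    Finset.sum_le_sum fun i hi =>
      log_abs_add_tent_mul_log_le hk hR (Finset.mem_filter.1 hi).2 (hbd i)
  have hcard : ∑ i with lam i ≠ 0, Real.log R ≤ Fintype.card ι * Real.log R := by
    rw [← nsmul_eq_mul, ← Finset.card_univ, ← Finset.sum_const]
    exact Finset.sum_le_sum_of_subset_of_nonneg (Finset.filter_subset _ _)
        fun _ _ _ => Real.log_nonneg hR
  rw [Finset.sum_add_distrib, ← Finset.sum_mul] at hsum
  linarith

theorem tendsto_of_forall_dist_le {α : Type*} [PseudoMetricSpace α] {a : ℕ → α} {x : α}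
    {b : ℕ → ℕ → α} {y : ℕ → α} {e : ℕ → ℝ} (hb : ∀ k, Tendsto (b k) atTop (𝓝 (y k)))
    (hy : Tendsto y atTop (𝓝 x)) (he : Tendsto e atTop (𝓝 0))
    (hab : ∀ᶠ k in atTop, ∀ n, dist (a n) (b k n) ≤ e k) : Tendsto a atTop (𝓝 x) := by
  rw [Metric.tendsto_nhds]
  intro δ hδ
  obtain ⟨k, h1, h2, h3⟩ := (hab.and ((he.eventually_lt_const (show 0 < δ / 3 by positivity)).and
    (Metric.tendsto_nhds.1 hy (δ / 3) (by positivity)))).exists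
  filter_upwards [Metric.tendsto_nhds.1 (hb k) (δ / 3) (by positivity)] with n hn
  have := dist_triangle4 (a n) (b k n) (y k) x
  have := h1 n
  linarith

/-- Matrix-level approximation theorem: let `Aₙ` be symmetric integer `dₙ×dₙ` matrices
with all eigenvalues (listed with multiplicity, i.e. the real characteristic polynomial
factors as `∏ (X - λᵢ)`) bounded by `R ≥ 1` in absolute value, let `vₙ > 0` with
`dₙ ≤ c·vₙ`, and let `μₙ = vₙ⁻¹ ∑ᵢ δ_{λᵢ(Aₙ)}`. If `μₙ` converges weakly to a finite
Borel measure `μ`, then `μₙ({0}) → μ({0})`. -/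
theorem stmt_10
    (d : ℕ → ℕ) (A : ∀ n, Matrix (Fin (d n)) (Fin (d n)) ℤ)
    (hsymm : ∀ n, (A n).IsSymm)
    (lam : ∀ n, Fin (d n) → ℝ)
    (hchar : ∀ n, ((A n).map (Int.cast : ℤ → ℝ)).charpoly
        = ∏ i, (X - C (lam n i)))
    (R : ℝ) (hR : 1 ≤ R) (hbd : ∀ n i, |lam n i| ≤ R)
    (v : ℕ → ℝ) (hv : ∀ n, 0 < v n)
    (c : ℝ) (hc : 0 ≤ c) (hdv : ∀ n, (d n : ℝ) ≤ c * v n)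
    (μs : ℕ → Measure ℝ)
    (hμs : ∀ n, μs n
        = (ENNReal.ofReal (v n))⁻¹ • ∑ i : Fin (d n), Measure.dirac (lam n i))
    (μ : Measure ℝ) [IsFiniteMeasure μ]
    (hweak : ∀ f : BoundedContinuousFunction ℝ ℝ,
      Tendsto (fun n => ∫ t, f t ∂(μs n)) atTop (𝓝 (∫ t, f t ∂μ))) :
    Tendsto (fun n => μs n {0}) atTop (𝓝 (μ {0})) := by
  have hv0 : ∀ n, ENNReal.ofReal (v n) ≠ 0 := fun n => by simpa using hv n
  have hfin : ∀ n, IsFiniteMeasure (μs n) := fun n => by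
    rw [hμs n]
    exact Measure.smul_finite _ (ENNReal.inv_ne_top.2 (hv0 n))
  have hint : ∀ (f : ℝ → ℝ) n, ∫ t, f t ∂(μs n) = (v n)⁻¹ * ∑ i, f (lam n i) := fun f n => by
    rw [hμs n, integral_smul_measure, integral_finsetSum_measure
      fun i _ => integrable_dirac (by simp)]
    simp [ENNReal.toReal_inv, ENNReal.toReal_ofReal (hv n).le]
  have hmass : ∀ n, (μs n).real {0} = (v n)⁻¹ * ∑ i with lam n i = 0, 1 := fun n => by
    rw [← integral_indicator_one (measurableSet_singleton 0), hint, Finset.sum_filter]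
    simp [Set.indicator_apply]
  have hsub : ∀ k n, ∫ t, tent k t ∂(μs n) - (μs n).real {0}
      = (v n)⁻¹ * ∑ i with lam n i ≠ 0, tent k (lam n i) := fun k n => by
    rw [hint, hmass, ← mul_sub,
      ← Finset.sum_filter_add_sum_filter_not Finset.univ (fun i => lam n i = 0)]
    have : ∑ i with lam n i = 0, tent k (lam n i) = ∑ i with lam n i = 0, 1 :=
      Finset.sum_congr rfl fun i hi => by rw [(Finset.mem_filter.1 hi).2, tent_zero]
    rw [this, add_sub_cancel_left]
  have hp : ∀ n, (A n).charpoly.map (Int.castRingHom ℝ) = ∏ i, (X - C (lam n i)) := fun n => by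
    rw [← hchar n, ← Matrix.charpoly_map]
    rfl
  have hreal : Tendsto (fun n => (μs n).real {0}) atTop (𝓝 (μ.real {0})) := by
    refine tendsto_of_forall_dist_le (b := fun k n => ∫ t, tent k t ∂(μs n))
      (e := fun k => c * Real.log R / Real.log k) (fun k => hweak (tent k))
      (tendsto_integral_tent μ)
      ((Real.tendsto_log_atTop.comp tendsto_natCast_atTop_atTop).const_div_atTop _) ?_
    filter_upwards [eventually_ge_atTop 2] with k hk n
    have hlogk : 0 < Real.log k := Real.log_pos (by exact_mod_cast hk)
    have hnonneg : 0 ≤ ∑ i with lam n i ≠ 0, tent k (lam n i) :=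
      Finset.sum_nonneg fun i _ => tent_nonneg k _
    rw [dist_comm, Real.dist_eq, hsub,
      abs_of_nonneg (mul_nonneg (inv_nonneg.2 (hv n).le) hnonneg), le_div_iff₀ hlogk, mul_assoc,
      inv_mul_le_iff₀ (hv n)]
    have h1 := sum_tent_mul_log_le (A n).charpoly (lam n) (hp n) hR (hbd n) (k := k) (by omega)
    rw [Fintype.card_fin] at h1
    have h2 := mul_le_mul_of_nonneg_right (hdv n) (Real.log_nonneg hR)
    linarith
  exact (ENNReal.tendsto_toReal_iff (fun n => measure_ne_top _ _) (measure_ne_top _ _)).1 hreal
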